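/- arXiv:2201.08681 — 2 statements merged into one kernel-verified Lean document; each statement's English description precedes it below -/
import Mathlib

section
/- Let κ be an uncountable cardinal carrying a κ-complete nonprincipal ultrafilter (i.e. κ is a measurable cardinal). Then Maker has a winning strategy in the Maker-Breaker game MB(K_κ, K_κ). -/
open Cardinal

universe u v

/-- A strategy in a transfinite positional game with moves of type `α`:
given the current turn (an ordinal) and the history of all moves made at
earlier turns, it produces a move. -/
def MBStrategy (α : Type u) : Type (u + 1) :=
  ∀ γ : Ordinal.{u}, (∀ β : Ordinal.{u}, β < γ → α) → α

/-- A completed play of a transfinite positional game on the board `board`: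
an ordinal-indexed sequence of moves, each an element of the board that was not
claimed at any earlier turn, which goes on until every element of the board has
been claimed. -/
structure MBPlay {α : Type u} (board : Set α) : Type (u + 1) where
  len : Ordinal.{u}
  move : ∀ γ : Ordinal.{u}, γ < len → α
  move_mem : ∀ γ h, move γ h ∈ board
  move_inj : ∀ γ₁ h₁ γ₂ h₂, move γ₁ h₁ = move γ₂ h₂ → γ₁ = γ₂
  complete : ∀ e ∈ board, ∃ γ h, move γ h = e

namespace MBPlay

variable {α : Type u} {board : Set α}

/-- The set of board elements claimed at the turns satisfying `turns`. -/
def claimed (p : MBPlay board) (turns : Ordinal.{u} → Prop) : Set α :=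
  {e | ∃ γ h, turns γ ∧ p.move γ h = e}

/-- The play is consistent with the player moving at the turns satisfying
`turns` using the strategy `σ`. -/
def Follows (p : MBPlay board) (turns : Ordinal.{u} → Prop) (σ : MBStrategy α) : Prop :=
  ∀ γ h, turns γ → p.move γ h = σ γ (fun β hβ => p.move β (hβ.trans h))

end MBPlay

/-- In the Maker–Breaker game the moves alternate with Maker moving first: the
turn `γ` belongs to Maker iff `γ % 2 = 0`.  In particular turn `0` and all
limit turns belong to Maker, and Breaker answers Maker's preceding move. -/
def makerTurn (γ : Ordinal.{u}) : Prop := γ % 2 = 0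

/-- The turns on which Breaker moves in the Maker–Breaker game. -/
def breakerTurn (γ : Ordinal.{u}) : Prop := γ % 2 = 1

/-- A strategy is legal for the player moving at the turns satisfying `turns`
if at every position (arising at such a turn) in which some element of the
board is still unclaimed, it produces an unclaimed element of the board. -/
def MBStrategy.IsLegal {α : Type u} (σ : MBStrategy α) (board : Set α)
    (turns : Ordinal.{u} → Prop) : Prop :=
  ∀ (γ : Ordinal.{u}) (hist : ∀ β : Ordinal.{u}, β < γ → α), turns γ →
    (∀ β h, hist β h ∈ board) →
    (∀ β₁ h₁ β₂ h₂, hist β₁ h₁ = hist β₂ h₂ → β₁ = β₂) →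
    (∃ e ∈ board, ∀ β h, hist β h ≠ e) →
    σ γ hist ∈ board ∧ ∀ β h, hist β h ≠ σ γ hist

/-- `G` contains a copy of `H`, i.e. a subgraph isomorphic to `H`; equivalently
there is an injective graph homomorphism from `H` into `G`. -/
def ContainsCopy {V : Type u} {W : Type v} (G : SimpleGraph V) (H : SimpleGraph W) : Prop :=
  ∃ f : H →g G, Function.Injective f

/-- Maker has a winning strategy in the Maker–Breaker game `MB(G, H)`:
playing at the even turns (including turn `0` and all limit turns) of a
transfinite play on the edge set of `G`, she can ensure that whatever Breaker
does at the odd turns, at the end of the play the graph formed by her claimed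
edges contains a copy of `H`. -/
def MakerWins {V : Type u} {W : Type v} (G : SimpleGraph V) (H : SimpleGraph W) : Prop :=
  ∃ σ : MBStrategy (Sym2 V), σ.IsLegal G.edgeSet makerTurn ∧
    ∀ p : MBPlay G.edgeSet, p.Follows makerTurn σ →
      ContainsCopy (SimpleGraph.fromEdgeSet (p.claimed makerTurn)) H

/-- Breaker has a winning strategy in the Maker–Breaker game `MB(G, H)`:
playing at the odd turns of a transfinite play on the edge set of `G`, he can
ensure that at the end of the play the graph formed by Maker's claimed edges
does not contain a copy of `H`. -/
def BreakerWins {V : Type u} {W : Type v} (G : SimpleGraph V) (H : SimpleGraph W) : Prop :=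
  ∃ σ : MBStrategy (Sym2 V), σ.IsLegal G.edgeSet breakerTurn ∧
    ∀ p : MBPlay G.edgeSet, p.Follows breakerTurn σ →
      ¬ ContainsCopy (SimpleGraph.fromEdgeSet (p.claimed makerTurn)) H

/-- Transfinite recursion with choice: if the requirement `R` at stage `δ` depends only on the
earlier values and the earlier inputs, then there is a solution operator whose value at `δ`
depends only on the inputs before `δ` and meets the requirement whenever it can be met. -/
theorem exists_causal_solution {A B : Type*} [Nonempty A] [Nonempty B]
    (R : Ordinal.{u} → (Ordinal.{u} → A) → (Ordinal.{u} → B) → A → Prop)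
    (hR : ∀ δ a a' b b' q, (∀ ε < δ, a ε = a' ε) → (∀ ε < δ, b ε = b' ε) →
      R δ a b q → R δ a' b' q) :
    ∃ X : (Ordinal.{u} → B) → Ordinal.{u} → A,
      (∀ b b' δ, (∀ ε < δ, b ε = b' ε) → X b δ = X b' δ) ∧
      ∀ b δ, (∃ q, R δ (X b) b q) → R δ (X b) b (X b δ) := by
  classical
  let cut {C : Type _} [Nonempty C] (δ : Ordinal.{u}) (f : ∀ ε < δ, C) : Ordinal.{u} → C :=
    fun ε => if h : ε < δ then f ε h else Classical.arbitrary C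
  let X (b : Ordinal.{u} → B) : Ordinal.{u} → A :=
    WellFounded.fix (C := fun _ => A) Ordinal.lt_wf fun δ f =>
      Classical.epsilon (R δ (cut δ f)
        (fun ε => if ε < δ then b ε else Classical.arbitrary B))
  have hX (b δ) : X b δ = Classical.epsilon (R δ
      (fun ε => if ε < δ then X b ε else Classical.arbitrary A)
      (fun ε => if ε < δ then b ε else Classical.arbitrary B)) := by
    simp only [X]
    rw [WellFounded.fix_eq]
    simp [cut]
  refine ⟨X, fun b b' δ => ?_, fun b δ h => ?_⟩
  · induction δ using Ordinal.lt_wf.induction with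
    | _ δ ih =>
    intro h
    rw [hX, hX]
    congr 2
    · funext ε
      split_ifs with hε
      · exact ih ε hε fun ζ hζ => h ζ (hζ.trans hε)
      · rfl
    · funext ε
      split_ifs with hε
      · exact h ε hε
      · rfl
  · obtain ⟨q, hq⟩ := h
    rw [hX b δ]
    refine hR δ _ _ _ _ _ (fun ε hε => if_pos hε) (fun ε hε => if_pos hε)
      (Classical.epsilon_spec (p := R δ _ _) ⟨q, ?_⟩)
    exact hR δ _ _ _ _ _ (fun ε hε => (if_pos hε).symm) (fun ε hε => (if_pos hε).symm) hq

/-- A transfinite process in which at each time `δ` the vertex `walker δ` passes the vertex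
`target δ` in the direction `dir δ`. -/
structure Walk (V : Type u) where
  walker : Ordinal.{u} → V
  target : Ordinal.{u} → V
  dir : Ordinal.{u} → Bool

namespace Walk

variable {V : Type u} (W : Walk V) (r : V) (b : Ordinal.{u} → Sym2 V)

/-- The vertices passed by `x` before time `δ`, with the directions in which they were passed.
This is the position of `x` in a binary tree of vertices. -/
def trail (x : V) (δ : Ordinal.{u}) : Set (V × Bool) :=
  {q | ∃ ε < δ, W.walker ε = x ∧ W.target ε = q.1 ∧ W.dir ε = q.2}

/-- The vertex `x` is the walker at all times shortly before `δ`. -/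
def IsLast (x : V) (δ : Ordinal.{u}) : Prop :=
  ∃ ε < δ, ∀ ζ, ε ≤ ζ → ζ < δ → W.walker ζ = x

/-- The vertex `x` is the root or has walked before time `δ`. -/
def Seen (x : V) (δ : Ordinal.{u}) : Prop :=
  x = r ∨ ∃ ε < δ, W.walker ε = x

/-- At time `δ`, the last walker `v` is at the position occupied by `u`. -/
def Collide (δ : Ordinal.{u}) (v u : V) : Prop :=
  W.IsLast v δ ∧ u ≠ v ∧ W.Seen r u δ ∧ W.trail u δ = W.trail v δ

/-- Before time `δ`, the vertex `v` has not been involved in the game. -/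
def Fresh (δ : Ordinal.{u}) (v : V) : Prop :=
  v ≠ r ∧ ∀ ε < δ, W.walker ε ≠ v ∧ v ∉ b ε

/-- The rule choosing the walker and its target at time `δ`: the last walker goes on as long as
its position is occupied; then a fresh vertex starts at the root. -/
def Rule (δ : Ordinal.{u}) (v u : V) : Prop :=
  W.Collide r δ v u ∨ (∀ v' u', ¬ W.Collide r δ v' u') ∧ W.Fresh r b δ v ∧ u = r

/-- If at time `δ` the walker `v` passes `u` and Breaker claims the edge `e`, then `e` joins `v` to
a vertex which has passed `u` in the direction `true`. -/
def Blocks (δ : Ordinal.{u}) (v u : V) (e : Sym2 V) : Prop :=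
  ∃ x, e = s(v, x) ∧ (u, true) ∈ W.trail x δ

/-- The walk obeys the rules against the moves `b` of Breaker up to time `Ω`. -/
structure IsGood (Ω : Ordinal.{u}) : Prop where
  rule : ∀ δ < Ω, W.Rule r b δ (W.walker δ) (W.target δ)
  dir : ∀ δ < Ω, W.dir δ = true ↔ ¬ W.Blocks δ (W.walker δ) (W.target δ) (b δ)

section Congr

variable {W W' : Walk V} {δ : Ordinal.{u}}

/-- The two walks agree before time `δ`. -/
def AgreeBelow (W W' : Walk V) (δ : Ordinal.{u}) : Prop :=
  ∀ ε < δ, W.walker ε = W'.walker ε ∧ W.target ε = W'.target ε ∧ W.dir ε = W'.dir ε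

theorem AgreeBelow.trail_eq (h : W.AgreeBelow W' δ) (x : V) : W.trail x δ = W'.trail x δ := by
  ext q
  refine exists_congr fun ε => and_congr_right fun hε => ?_
  rw [(h ε hε).1, (h ε hε).2.1, (h ε hε).2.2]

theorem AgreeBelow.isLast_iff (h : W.AgreeBelow W' δ) (x : V) :
    W.IsLast x δ ↔ W'.IsLast x δ := by
  refine exists_congr fun ε => and_congr_right fun _ => forall_congr' fun ζ =>
    forall_congr' fun _ => forall_congr' fun hζ => ?_
  rw [(h ζ hζ).1]

theorem AgreeBelow.seen_iff (h : W.AgreeBelow W' δ) (r x : V) :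
    W.Seen r x δ ↔ W'.Seen r x δ := by
  refine or_congr Iff.rfl (exists_congr fun ε => and_congr_right fun hε => ?_)
  rw [(h ε hε).1]

theorem AgreeBelow.collide_iff (h : W.AgreeBelow W' δ) (r v u : V) :
    W.Collide r δ v u ↔ W'.Collide r δ v u := by
  simp only [Collide, h.isLast_iff, h.seen_iff, h.trail_eq]

theorem AgreeBelow.fresh_iff (h : W.AgreeBelow W' δ) (r : V) {b b' : Ordinal.{u} → Sym2 V}
    (hb : ∀ ε < δ, b ε = b' ε) (v : V) : W.Fresh r b δ v ↔ W'.Fresh r b' δ v := by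
  refine and_congr_right fun _ => forall_congr' fun ε => forall_congr' fun hε => ?_
  rw [(h ε hε).1, hb ε hε]

theorem AgreeBelow.rule_iff (h : W.AgreeBelow W' δ) (r : V) {b b' : Ordinal.{u} → Sym2 V}
    (hb : ∀ ε < δ, b ε = b' ε) (v u : V) : W.Rule r b δ v u ↔ W'.Rule r b' δ v u := by
  simp only [Rule, h.collide_iff, h.fresh_iff r hb]

theorem AgreeBelow.blocks_iff (h : W.AgreeBelow W' δ) (v u : V) (e : Sym2 V) :
    W.Blocks δ v u e ↔ W'.Blocks δ v u e := by
  simp only [Blocks, h.trail_eq]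

end Congr

variable {W r b} {Ω : Ordinal.{u}}

theorem trail_mono (x : V) {δ δ' : Ordinal.{u}} (h : δ ≤ δ') : W.trail x δ ⊆ W.trail x δ' :=
  fun _ ⟨ε, hε, hq⟩ => ⟨ε, hε.trans_le h, hq⟩

theorem IsLast.eq {x y : V} {δ : Ordinal.{u}} (hx : W.IsLast x δ) (hy : W.IsLast y δ) :
    x = y := by
  obtain ⟨ε, hε, h⟩ := hx
  obtain ⟨ε', hε', h'⟩ := hy
  rw [← h (max ε ε') (le_max_left _ _) (max_lt hε hε'),
    ← h' (max ε ε') (le_max_right _ _) (max_lt hε hε')]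

namespace IsGood

theorem exists_fresh (H : W.IsGood r b Ω) (δ : Ordinal.{u}) (hδ : δ < Ω) :
    ∃ η ≤ δ, W.walker η = W.walker δ ∧ W.Fresh r b η (W.walker δ) := by
  induction δ using Ordinal.lt_wf.induction with
  | _ δ ih =>
  rcases H.rule δ hδ with h | h
  · obtain ⟨ε, hε, hε'⟩ := h.1
    obtain ⟨η, hη, h₁, h₂⟩ := ih ε hε (hε.trans hδ)
    rw [hε' ε le_rfl hε] at h₁ h₂
    exact ⟨η, hη.trans hε.le, h₁, h₂⟩
  · exact ⟨δ, le_rfl, rfl, h.2.1⟩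

theorem walker_ne_root (H : W.IsGood r b Ω) {δ : Ordinal.{u}} (hδ : δ < Ω) :
    W.walker δ ≠ r := by
  obtain ⟨η, -, -, h⟩ := H.exists_fresh δ hδ
  exact h.1

/-- The times at which a given vertex is the walker form an interval. -/
theorem walker_eq_of_le (H : W.IsGood r b Ω) {δ ε ζ : Ordinal.{u}} (hδ : δ < Ω)
    (hεζ : ε ≤ ζ) (hζδ : ζ ≤ δ) (h : W.walker ε = W.walker δ) : W.walker ζ = W.walker δ := by
  induction δ using Ordinal.lt_wf.induction with
  | _ δ ih =>
  rcases hζδ.eq_or_lt with rfl | hζδ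
  · rfl
  rcases H.rule δ hδ with hc | hc
  · obtain ⟨ε', hε', hlast⟩ := hc.1
    rcases le_or_gt ε' ζ with hle | hlt
    · exact hlast ζ hle hζδ
    · have := hlast ε' le_rfl hε'
      rw [← this]
      exact ih ε' hε' (hε'.trans hδ) hlt.le (h.trans this.symm)
  · exact absurd h (hc.2.1.2 ε (hεζ.trans_lt hζδ)).1

theorem walker_ne_of_seen (H : W.IsGood r b Ω) {x : V} {δ δ' : Ordinal.{u}}
    (hx : W.Seen r x δ) (hne : W.walker δ ≠ x) (hδ : δ ≤ δ') (hδ' : δ' < Ω) :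
    W.walker δ' ≠ x := by
  rcases hx with rfl | ⟨ε, hε, rfl⟩
  · exact H.walker_ne_root hδ'
  · intro h
    exact hne ((H.walker_eq_of_le hδ' hε.le hδ h.symm).trans h)

/-- Once a vertex has stopped walking, its trail no longer changes. -/
theorem trail_eq_of_seen (H : W.IsGood r b Ω) {x : V} {δ δ' : Ordinal.{u}}
    (hx : W.Seen r x δ) (hne : W.walker δ ≠ x) (hδ : δ ≤ δ') (hδ' : δ' ≤ Ω) :
    W.trail x δ' = W.trail x δ := by
  refine Set.Subset.antisymm ?_ (trail_mono x hδ)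
  rintro q ⟨ε, hε, hεx, hq⟩
  refine ⟨ε, lt_of_not_ge fun hle => ?_, hεx, hq⟩
  exact H.walker_ne_of_seen hx hne hle (hε.trans_le hδ') hεx

theorem target_spec (H : W.IsGood r b Ω) {δ : Ordinal.{u}} (hδ : δ < Ω) :
    W.target δ ≠ W.walker δ ∧ W.Seen r (W.target δ) δ ∧
      W.trail (W.target δ) δ = W.trail (W.walker δ) δ := by
  rcases H.rule δ hδ with h | ⟨-, hf, ht⟩
  · exact h.2
  · rw [ht]
    refine ⟨hf.1.symm, Or.inl rfl, ?_⟩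
    trans ∅
    · refine Set.eq_empty_of_forall_notMem ?_
      rintro q ⟨ε, hε, h, -⟩
      exact H.walker_ne_root (hε.trans hδ) h
    · refine (Set.eq_empty_of_forall_notMem ?_).symm
      rintro q ⟨ε, hε, h, -⟩
      exact (hf.2 ε hε).1 h

theorem self_notMem_trail (H : W.IsGood r b Ω) {δ : Ordinal.{u}} (hδ : δ ≤ Ω) (x : V)
    (c : Bool) : (x, c) ∉ W.trail x δ := by
  rintro ⟨ε, hε, hw, ht, -⟩
  exact (H.target_spec (hε.trans_le hδ)).1 (ht.trans hw.symm)

theorem target_ne_of_lt (H : W.IsGood r b Ω) {ε δ : Ordinal.{u}} (hε : ε < δ) (hδ : δ < Ω)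
    (hw : W.walker ε = W.walker δ) : W.target ε ≠ W.target δ := by
  intro ht
  refine H.self_notMem_trail hδ.le (W.target δ) (W.dir ε) ?_
  rw [(H.target_spec hδ).2.2]
  exact ⟨ε, hε, hw, ht, rfl⟩

theorem eq_of_walker_eq_of_target_eq (H : W.IsGood r b Ω) {ε δ : Ordinal.{u}} (hε : ε < Ω)
    (hδ : δ < Ω) (hw : W.walker ε = W.walker δ) (ht : W.target ε = W.target δ) : ε = δ := by
  rcases lt_trichotomy ε δ with h | h | h
  · exact absurd ht (H.target_ne_of_lt h hδ hw)
  · exact h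
  · exact absurd ht.symm (H.target_ne_of_lt h hε hw.symm)

theorem trail_functional (H : W.IsGood r b Ω) {δ : Ordinal.{u}} (hδ : δ ≤ Ω) {x u : V}
    {c c' : Bool} (h : (u, c) ∈ W.trail x δ) (h' : (u, c') ∈ W.trail x δ) : c = c' := by
  obtain ⟨ε, hε, hw, ht, hd⟩ := h
  obtain ⟨ε', hε', hw', ht', hd'⟩ := h'
  obtain rfl := H.eq_of_walker_eq_of_target_eq (hε.trans_le hδ) (hε'.trans_le hδ)
    (hw.trans hw'.symm) (ht.trans ht'.symm)
  exact hd.symm.trans hd'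

theorem dir_notMem_trail (H : W.IsGood r b Ω) {δ : Ordinal.{u}} (hδ : δ < Ω) {x : V}
    (hx : b δ = s(W.walker δ, x)) : (W.target δ, W.dir δ) ∉ W.trail x δ := by
  intro hmem
  have hdir := H.dir δ hδ
  cases hd : W.dir δ with
  | true =>
    rw [hd] at hmem
    exact hdir.1 hd ⟨x, hx, hmem⟩
  | false =>
    rw [hd] at hmem hdir
    simp only [Bool.false_eq_true, false_iff, not_not] at hdir
    obtain ⟨y, hy, hmem'⟩ := hdir
    obtain rfl : x = y := by
      rw [hx] at hy
      exact Sym2.congr_right.1 hy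
    exact absurd (H.trail_functional hδ.le hmem hmem') (by simp)

/-- The edges between walkers and targets are distinct from Breaker's earlier edges. -/
theorem edge_ne_breaker (H : W.IsGood r b Ω) {ε δ : Ordinal.{u}} (hε : ε < δ) (hδ : δ < Ω) :
    b ε ≠ s(W.walker δ, W.target δ) := by
  intro h
  obtain ⟨η, hη, hw, hf⟩ := H.exists_fresh δ hδ
  have hηε : η ≤ ε := by
    by_contra! hlt
    refine (hf.2 ε hlt).2 ?_
    rw [h]
    exact Sym2.mem_mk_left _ _
  have hwε : W.walker ε = W.walker δ := H.walker_eq_of_le hδ hηε hε.le hw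
  refine H.dir_notMem_trail (hε.trans hδ) (x := W.target δ) (by rw [h, hwε]) ?_
  obtain ⟨hne, -, heq⟩ := H.target_spec hδ
  have hmem : (W.target ε, W.dir ε) ∈ W.trail (W.target δ) δ := by
    rw [heq]
    exact ⟨ε, hε, hwε, rfl, rfl⟩
  obtain ⟨ζ, hζ, hwζ, hq⟩ := hmem
  refine ⟨ζ, lt_of_not_ge fun hle => hne ?_, hwζ, hq⟩
  rw [← hwζ]
  exact H.walker_eq_of_le hδ hle hζ.le hwε

/-- The edges between walkers and targets are distinct. -/
theorem edge_ne_edge (H : W.IsGood r b Ω) {ε δ : Ordinal.{u}} (hε : ε < δ) (hδ : δ < Ω) :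
    s(W.walker ε, W.target ε) ≠ s(W.walker δ, W.target δ) := by
  intro h
  rcases Sym2.eq_iff.1 h with ⟨hw, ht⟩ | ⟨hw, ht⟩
  · exact H.target_ne_of_lt hε hδ hw ht
  · rcases (H.target_spec (hε.trans hδ)).2.1 with hr | ⟨ζ, hζ, hwζ⟩
    · exact H.walker_ne_root hδ (ht.symm.trans hr)
    · have := H.walker_eq_of_le hδ hζ.le hε.le (hwζ.trans ht)
      exact (H.target_spec hδ).1 (hw.symm.trans this)

theorem target_not_isLast (H : W.IsGood r b Ω) {ε : Ordinal.{u}} (hε : ε < Ω) :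
    ¬ W.IsLast (W.target ε) Ω := by
  rintro ⟨ζ, hζ, h⟩
  obtain ⟨hne, hseen, -⟩ := H.target_spec hε
  exact H.walker_ne_of_seen hseen hne.symm (le_max_left ε ζ) (max_lt hε hζ)
    (h _ (le_max_right _ _) (max_lt hε hζ))

theorem trail_target (H : W.IsGood r b Ω) {ε : Ordinal.{u}} (hε : ε < Ω) :
    W.trail (W.target ε) Ω = W.trail (W.walker ε) ε := by
  obtain ⟨hne, hseen, heq⟩ := H.target_spec hε
  rw [← heq]
  exact H.trail_eq_of_seen hseen hne.symm hε.le le_rfl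

theorem seen_target (H : W.IsGood r b Ω) {ε : Ordinal.{u}} (hε : ε < Ω) :
    W.Seen r (W.target ε) Ω :=
  (H.target_spec hε).2.1.imp id fun ⟨ζ, hζ, h⟩ => ⟨ζ, hζ.trans hε, h⟩

theorem trail_subset_of_mem (H : W.IsGood r b Ω) {u v : V} {c : Bool}
    (h : (u, c) ∈ W.trail v Ω) : W.trail u Ω ⊆ W.trail v Ω := by
  obtain ⟨ε, hε, rfl, rfl, -⟩ := h
  rw [H.trail_target hε]
  exact trail_mono _ hε.le

theorem trail_ne_of_not_isLast (H : W.IsGood r b Ω) {x : V} {ε : Ordinal.{u}} (hε : ε < Ω)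
    (hx : W.Seen r x ε) (hne : W.walker ε ≠ x) (hlast : ¬ W.IsLast (W.walker ε) Ω) :
    W.trail x Ω ≠ W.trail (W.walker ε) Ω := by
  intro heq
  set y := W.walker ε with hy
  have hex : ∃ η, ε ≤ η ∧ η < Ω ∧ W.walker η ≠ y := by
    by_contra! hall
    exact hlast ⟨ε, hε, hall⟩
  obtain ⟨η, ⟨hεη, hη, hηy⟩, hmin⟩ := WellFounded.has_min Ordinal.lt_wf
    {η | ε ≤ η ∧ η < Ω ∧ W.walker η ≠ y} hex
  have hεη' : ε < η := hεη.lt_of_ne fun h => hηy (h ▸ hy.symm)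
  have hlasty : W.IsLast y η := by
    refine ⟨ε, hεη', fun ζ hζ hζη => ?_⟩
    by_contra hζy
    exact hmin ζ ⟨hζ, hζη.trans hη, hζy⟩ hζη
  have hxη : W.Seen r x η := hx.imp id fun ⟨ζ, hζ, h⟩ => ⟨ζ, hζ.trans hεη', h⟩
  have hcol : W.Collide r η y x := by
    refine ⟨hlasty, hne.symm, hxη, ?_⟩
    rw [← H.trail_eq_of_seen hxη (H.walker_ne_of_seen hx hne hεη hη) hη.le le_rfl, heq]
    exact H.trail_eq_of_seen (Or.inr ⟨ε, hεη', rfl⟩) hηy hη.le le_rfl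
  rcases H.rule η hη with h | h
  · exact hηy (h.1.eq hlasty)
  · exact h.1 _ _ hcol

/-- Distinct vertices that have stopped walking have distinct positions. -/
theorem eq_of_trail_eq (H : W.IsGood r b Ω) {x y : V} (hx : W.Seen r x Ω) (hy : W.Seen r y Ω)
    (hx' : ¬ W.IsLast x Ω) (hy' : ¬ W.IsLast y Ω) (h : W.trail x Ω = W.trail y Ω) :
    x = y := by
  by_contra hne
  rcases hx with rfl | ⟨ε, hε, rfl⟩
  · rcases hy with rfl | ⟨ζ, hζ, rfl⟩
    · exact hne rfl
    · exact H.trail_ne_of_not_isLast hζ (Or.inl rfl) (Ne.symm hne) hy' h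
  · rcases hy with rfl | ⟨ζ, hζ, rfl⟩
    · exact H.trail_ne_of_not_isLast hε (Or.inl rfl) hne hx' h.symm
    · rcases lt_trichotomy ε ζ with hlt | rfl | hlt
      · exact H.trail_ne_of_not_isLast hζ (Or.inr ⟨ε, hlt, rfl⟩) (Ne.symm hne) hy' h
      · exact hne rfl
      · exact H.trail_ne_of_not_isLast hε (Or.inr ⟨ζ, hlt, rfl⟩) hne hx' h.symm

/-- Two vertices on a common trail are joined by an edge between a walker and its target. -/
theorem exists_edge_of_mem_trail (H : W.IsGood r b Ω) {u u' v : V} {c c' : Bool} (hne : u ≠ u')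
    (h : (u, c) ∈ W.trail v Ω) (h' : (u', c') ∈ W.trail v Ω) :
    ∃ ε < Ω, s(W.walker ε, W.target ε) = s(u, u') := by
  obtain ⟨ε, hε, hw, ht, -⟩ := h
  obtain ⟨ε', hε', hw', ht', -⟩ := h'
  dsimp only at ht ht'
  have key : ∀ {ε ε' : Ordinal.{u}}, ε < ε' → ε' < Ω → W.walker ε = W.walker ε' →
      ∃ ζ < Ω, s(W.walker ζ, W.target ζ) = s(W.target ε', W.target ε) := by
    intro ε ε' hlt hε' hw
    have hmem : (W.target ε, W.dir ε) ∈ W.trail (W.target ε') Ω := by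
      rw [H.trail_target hε']
      exact ⟨ε, hlt, hw, rfl, rfl⟩
    obtain ⟨ζ, hζ, h₁, h₂, -⟩ := hmem
    exact ⟨ζ, hζ, by rw [h₁, h₂]⟩
  subst ht ht'
  rcases lt_trichotomy ε ε' with hlt | rfl | hlt
  · rw [Sym2.eq_swap]
    exact key hlt hε' (hw.trans hw'.symm)
  · exact absurd rfl hne
  · exact key hlt hε (hw'.trans hw.symm)

end IsGood

end Walk

theorem mk_image_Iio_lt {V : Type u} {κ : Cardinal.{u}} (f : Ordinal.{u} → V) {δ : Ordinal.{u}}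
    (hδ : δ < κ.ord) : #(f '' Set.Iio δ) < κ := by
  have h := Cardinal.mk_image_le_lift (f := f) (s := Set.Iio δ)
  rw [Cardinal.mk_Iio_ordinal, Cardinal.lift_lift] at h
  have h' : #(f '' Set.Iio δ) ≤ δ.card := by
    rwa [Cardinal.lift_le] at h
  exact h'.trans_lt (Cardinal.lt_ord.1 hδ)

namespace Walk

variable {V : Type u} {κ : Cardinal.{u}}

theorem exists_fresh_vertex (hκ : ℵ₀ ≤ κ) (hV : #V = κ) (W : Walk V) (r : V)
    (b : Ordinal.{u} → Sym2 V) {δ : Ordinal.{u}} (hδ : δ < κ.ord) : ∃ v, W.Fresh r b δ v := by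
  let S : Set V := {r} ∪ (W.walker '' Set.Iio δ ∪ ((fun ε => (b ε).out.1) '' Set.Iio δ ∪
    (fun ε => (b ε).out.2) '' Set.Iio δ))
  have hS : #S < κ := by
    have key {A B : Set V} (hA : #A < κ) (hB : #B < κ) : #(A ∪ B : Set V) < κ :=
      (Cardinal.mk_union_le A B).trans_lt (Cardinal.add_lt_of_lt hκ hA hB)
    refine key ?_ (key (mk_image_Iio_lt _ hδ) (key (mk_image_Iio_lt _ hδ) (mk_image_Iio_lt _ hδ)))
    rw [Cardinal.mk_singleton]
    exact Cardinal.one_lt_aleph0.trans_le hκ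
  obtain ⟨v, hv⟩ : ∃ v, v ∉ S := by
    by_contra! hall
    rw [Set.eq_univ_of_forall hall, Cardinal.mk_univ, hV] at hS
    exact hS.false
  refine ⟨v, fun h => hv (Or.inl h), fun ε hε => ⟨fun h => hv (Or.inr (Or.inl ⟨ε, hε, h⟩)),
    fun h => hv (Or.inr (Or.inr ?_))⟩⟩
  have h' : v ∈ s((b ε).out.1, (b ε).out.2) := by
    rwa [show s((b ε).out.1, (b ε).out.2) = b ε from Quot.out_eq _]
  rcases Sym2.mem_iff.1 h' with h | h
  · exact Or.inl ⟨ε, hε, h.symm⟩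
  · exact Or.inr ⟨ε, hε, h.symm⟩

/-- Against any sequence of moves of Breaker there is a good walk, whose walker and target at any
time depend only on the earlier moves of Breaker. -/
theorem exists_isGood (hκ : ℵ₀ ≤ κ) (hV : #V = κ) (r : V) :
    ∃ W : (Ordinal.{u} → Sym2 V) → Walk V,
      (∀ b b' δ, (∀ ε < δ, b ε = b' ε) →
        (W b).walker δ = (W b').walker δ ∧ (W b).target δ = (W b').target δ) ∧
      ∀ b, (W b).IsGood r b κ.ord := by
  classical
  have : Nonempty V := ⟨r⟩
  have : Nonempty (Sym2 V) := ⟨s(r, r)⟩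
  let A := V × V × (Sym2 V → Bool)
  let toWalk (a : Ordinal.{u} → A) (b : Ordinal.{u} → Sym2 V) : Walk V :=
    ⟨fun ε => (a ε).1, fun ε => (a ε).2.1, fun ε => (a ε).2.2 (b ε)⟩
  let R (δ : Ordinal.{u}) (a : Ordinal.{u} → A) (b : Ordinal.{u} → Sym2 V) (q : A) : Prop :=
    (toWalk a b).Rule r b δ q.1 q.2.1 ∧
      ∀ e, q.2.2 e = true ↔ ¬ (toWalk a b).Blocks δ q.1 q.2.1 e
  obtain ⟨X, hX, hXR⟩ := exists_causal_solution R (by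
    rintro δ a a' b b' q ha hb ⟨h₁, h₂⟩
    have hagree : (toWalk a b).AgreeBelow (toWalk a' b') δ := by
      intro ε hε
      simp only [toWalk, ha ε hε, hb ε hε, and_self]
    refine ⟨(hagree.rule_iff r hb _ _).1 h₁, fun e => ?_⟩
    rw [h₂ e, hagree.blocks_iff])
  have hR (b : Ordinal.{u} → Sym2 V) (δ : Ordinal.{u}) (hδ : δ < κ.ord) :
      R δ (X b) b (X b δ) := by
    refine hXR b δ ?_
    obtain ⟨v, u, hvu⟩ : ∃ v u, (toWalk (X b) b).Rule r b δ v u := by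
      by_cases hc : ∃ v u, (toWalk (X b) b).Collide r δ v u
      · obtain ⟨v, u, h⟩ := hc
        exact ⟨v, u, Or.inl h⟩
      · push Not at hc
        obtain ⟨v, hv⟩ := exists_fresh_vertex hκ hV (toWalk (X b) b) r b hδ
        exact ⟨v, r, Or.inr ⟨hc, hv, rfl⟩⟩
    exact ⟨⟨v, u, fun e => decide (¬ (toWalk (X b) b).Blocks δ v u e)⟩, hvu, fun e => by simp⟩
  refine ⟨fun b => toWalk (X b) b, fun b b' δ h => ?_, fun b => ⟨fun δ hδ => (hR b δ hδ).1,
    fun δ hδ => (hR b δ hδ).2 (b δ)⟩⟩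
  simp only [toWalk, hX b b' δ h, and_self]

variable {W : Walk V} {r : V} {b : Ordinal.{u} → Sym2 V}

theorem IsGood.le_mk_settled (H : W.IsGood r b κ.ord) (hκ : ℵ₀ ≤ κ) :
    κ ≤ #{x | W.Seen r x κ.ord ∧ ¬ W.IsLast x κ.ord} := by
  by_contra! hlt
  set P : Set V := {x | W.Seen r x κ.ord ∧ ¬ W.IsLast x κ.ord}
  let T : Set V := {x | W.Seen r x κ.ord}
  have hT : #T < κ := by
    have hsub : T ⊆ P ∪ {x | W.IsLast x κ.ord} := fun x hx => by
      by_cases h : W.IsLast x κ.ord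
      · exact Or.inr h
      · exact Or.inl ⟨hx, h⟩
    have hone : #{x | W.IsLast x κ.ord} ≤ 1 :=
      Cardinal.mk_le_one_iff_set_subsingleton.2 fun x hx y hy => hx.eq hy
    exact (Cardinal.mk_le_mk_of_subset hsub).trans_lt ((Cardinal.mk_union_le _ _).trans_lt
      (Cardinal.add_lt_of_lt hκ hlt (hone.trans_lt (Cardinal.one_lt_aleph0.trans_le hκ))))
  let f : Set.Iio κ.ord → T × T := fun δ =>
    (⟨W.walker δ, Or.inr ⟨δ, δ.2, rfl⟩⟩, ⟨W.target δ, H.seen_target δ.2⟩)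
  have hf : Function.Injective f := by
    intro ε δ h
    exact Subtype.ext (H.eq_of_walker_eq_of_target_eq ε.2 δ.2
      (congrArg (fun p => (p.1 : V)) h) (congrArg (fun p => (p.2 : V)) h))
  have hle := Cardinal.lift_mk_le_lift_mk_of_injective hf
  rw [Cardinal.mk_Iio_ordinal, Cardinal.lift_lift, Cardinal.lift_le, Cardinal.card_ord,
    ← Cardinal.mul_def] at hle
  exact (hle.trans_lt (Cardinal.mul_lt_of_lt hκ hT hT)).false

/-- If there is a `κ`-complete nonprincipal ultrafilter, then a good walk of length `κ` has
`κ` many vertices that are pairwise joined by edges between walkers and their targets. -/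
theorem IsGood.exists_clique (H : W.IsGood r b κ.ord) (hκ : ℵ₀ ≤ κ) (hV : #V = κ)
    (U : Ultrafilter V)
    (hcomplete : ∀ s : Set (Set V), #s < κ → (∀ A ∈ s, A ∈ U) → ⋂₀ s ∈ U)
    (hfree : ∀ A : Set V, A.Finite → A ∉ U) :
    ∃ f : V → V, Function.Injective f ∧ ∀ x y, x ≠ y →
      ∃ ε < κ.ord, s(W.walker ε, W.target ε) = s(f x, f y) := by
  set Ω := κ.ord
  obtain ⟨φ⟩ : Nonempty (V ↪ {x | W.Seen r x Ω ∧ ¬ W.IsLast x Ω}) := by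
    rw [← Cardinal.le_def, hV]
    exact H.le_mk_settled hκ
  let N (q : V × Bool) : Set V := {v | q ∈ W.trail (φ v : V) Ω}
  let s : Set (V × Bool) := {q | N q ∈ U}
  let C : Set V := {u | ∃ c, (u, c) ∈ s}
  suffices hC : κ ≤ #C by
    rw [← hV, Cardinal.le_def] at hC
    obtain ⟨f⟩ := hC
    refine ⟨fun x => f x, fun x y h => f.injective (Subtype.ext h), fun x y hne => ?_⟩
    obtain ⟨c, hc⟩ := (f x).2
    obtain ⟨c', hc'⟩ := (f y).2
    obtain ⟨v, hv, hv'⟩ := U.nonempty_of_mem (Filter.inter_mem hc hc')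
    exact H.exists_edge_of_mem_trail (fun h => hne (f.injective (Subtype.ext h))) hv hv'
  by_contra! hC
  have hs : #(N '' s) < κ := by
    have hsub : s ⊆ C ×ˢ Set.univ := fun q hq => ⟨⟨q.2, hq⟩, trivial⟩
    refine Cardinal.mk_image_le.trans_lt ((Cardinal.mk_le_mk_of_subset hsub).trans_lt ?_)
    rw [Cardinal.mk_congr (Equiv.Set.prod C Set.univ), Cardinal.mk_prod, Cardinal.mk_univ]
    refine Cardinal.mul_lt_of_lt hκ (by simpa using hC) ?_
    exact lt_of_lt_of_le (by simp) hκ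
  have hA : {v | s ⊆ W.trail (φ v : V) Ω} ∈ U := by
    refine Filter.mem_of_superset (hcomplete _ hs ?_) ?_
    · rintro _ ⟨q, hq, rfl⟩
      exact hq
    · intro v hv q hq
      exact hv _ ⟨q, hq, rfl⟩
  have hB : {v | W.trail (φ v : V) Ω = s}ᶜ ∈ U := by
    rw [Ultrafilter.compl_mem_iff_notMem]
    refine hfree _ (Set.Subsingleton.finite fun v hv v' hv' => ?_)
    exact φ.injective (Subtype.ext (H.eq_of_trail_eq (φ v).2.1 (φ v').2.1 (φ v).2.2 (φ v').2.2
      (hv.trans hv'.symm)))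
  have hstep : ∀ v, s ⊆ W.trail (φ v : V) Ω → W.trail (φ v : V) Ω ≠ s →
      ∃ u c, (u, c) ∈ W.trail (φ v : V) Ω ∧ W.Seen r u Ω ∧ ¬ W.IsLast u Ω ∧
        W.trail u Ω = s := by
    intro v hsub hne
    have hex : ∃ ε, ε < Ω ∧ W.walker ε = φ v ∧ (W.target ε, W.dir ε) ∉ s := by
      by_contra! hall
      refine hne (Set.Subset.antisymm ?_ hsub)
      rintro ⟨u, c⟩ ⟨ε, hε, hw, rfl, rfl⟩
      exact hall ε hε hw
    obtain ⟨ε, ⟨hε, hw, hns⟩, hmin⟩ := WellFounded.has_min Ordinal.lt_wf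
      {ε | ε < Ω ∧ W.walker ε = φ v ∧ (W.target ε, W.dir ε) ∉ s} hex
    refine ⟨W.target ε, W.dir ε, ⟨ε, hε, hw, rfl, rfl⟩, H.seen_target hε,
      H.target_not_isLast hε, ?_⟩
    rw [H.trail_target hε]
    refine Set.Subset.antisymm ?_ ?_
    · rintro ⟨u, c⟩ ⟨ζ, hζ, hwζ, rfl, rfl⟩
      by_contra hζs
      exact hmin ζ ⟨hζ.trans hε, hwζ.trans hw, hζs⟩ hζ
    · intro q hq
      obtain ⟨ζ, hζ, hwζ, htζ, hdζ⟩ := hsub hq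
      refine ⟨ζ, lt_of_not_ge fun hle => hns ?_, hwζ.trans hw.symm, htζ, hdζ⟩
      rcases hle.eq_or_lt with rfl | hlt
      · rw [htζ, hdζ]
        exact hq
      · refine Filter.mem_of_superset (show N q ∈ U from hq) fun v' hv' => ?_
        refine H.trail_subset_of_mem (u := q.1) (c := q.2) hv' ?_
        rw [← htζ, H.trail_target hζ]
        exact ⟨ε, hlt, hw.trans hwζ.symm, rfl, rfl⟩
  have hAB := Filter.inter_mem hA hB
  obtain ⟨v₀, hv₀, hv₀'⟩ := U.nonempty_of_mem hAB
  obtain ⟨u, c, -, hu, hu', hus⟩ := hstep v₀ hv₀ hv₀'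
  have hunion : N (u, true) ∪ N (u, false) ∈ U := by
    refine Filter.mem_of_superset hAB fun v ⟨hv, hv'⟩ => ?_
    obtain ⟨x, d, hx, hx₁, hx₂, hxs⟩ := hstep v hv hv'
    obtain rfl := H.eq_of_trail_eq hx₁ hu hx₂ hu' (hxs.trans hus.symm)
    cases d
    · exact Or.inr hx
    · exact Or.inl hx
  rcases Ultrafilter.union_mem_iff.1 hunion with h | h
  · exact H.self_notMem_trail le_rfl u true (hus.symm ▸ h)
  · exact H.self_notMem_trail le_rfl u false (hus.symm ▸ h)

end Walk

/-- To win the Maker–Breaker game it suffices for Maker to have a rule `F` choosing her `δ`-th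
edge from Breaker's earlier edges that always gives unclaimed edges for `δ < Ω` and
produces a copy of `H` by the time `Ω`. -/
theorem makerWins_of_rule {V : Type u} {W : Type v} {G : SimpleGraph V} {H : SimpleGraph W}
    [Nonempty V] (Ω : Ordinal.{u}) (F : (Ordinal.{u} → Sym2 V) → Ordinal.{u} → Sym2 V)
    (hcausal : ∀ b b' δ, (∀ ε < δ, b ε = b' ε) → F b δ = F b' δ)
    (hmem : ∀ b, ∀ δ < Ω, F b δ ∈ G.edgeSet)
    (hmaker : ∀ b, ∀ δ < Ω, ∀ ε < δ, F b ε ≠ F b δ)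
    (hbreaker : ∀ b, ∀ δ < Ω, ∀ ε < δ, b ε ≠ F b δ)
    (hcopy : ∀ b, ContainsCopy (SimpleGraph.fromEdgeSet (F b '' Set.Iio Ω)) H) :
    MakerWins G H := by
  classical
  have : Nonempty (Sym2 V) := ‹Nonempty V›.map fun v => s(v, v)
  let breaker (γ : Ordinal.{u}) (hist : ∀ β < γ, Sym2 V) : Ordinal.{u} → Sym2 V :=
    fun ε => if h : 2 * ε + 1 < γ then hist _ h else Classical.arbitrary _
  let free (γ : Ordinal.{u}) (hist : ∀ β < γ, Sym2 V) (e : Sym2 V) : Prop :=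
    e ∈ G.edgeSet ∧ ∀ β h, hist β h ≠ e
  let σ : MBStrategy (Sym2 V) := fun γ hist =>
    if free γ hist (F (breaker γ hist) (γ / 2)) then F (breaker γ hist) (γ / 2)
    else Classical.epsilon (free γ hist)
  refine ⟨σ, ?_, fun p hp => ?_⟩
  · intro γ hist _ _ _ hex
    change free γ hist (σ γ hist)
    simp only [σ]
    split_ifs with h
    · exact h
    · exact Classical.epsilon_spec (p := free γ hist) hex
  · let b := breaker p.len p.move
    have two_ne : (2 : Ordinal.{u}) ≠ 0 := two_ne_zero
    have hround {ε δ : Ordinal.{u}} (h : ε < δ) : 2 * ε + 1 < 2 * δ := by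
      have h₁ : 2 * (ε + 1) ≤ 2 * δ := by
        gcongr
        exact Order.add_one_le_of_lt h
      refine lt_of_lt_of_le ?_ h₁
      rw [mul_add, mul_one]
      gcongr
      exact one_lt_two
    have hplay (δ : Ordinal.{u}) (hδ : δ < Ω) : ∃ h : 2 * δ < p.len, p.move _ h = F b δ := by
      induction δ using Ordinal.lt_wf.induction with
      | _ δ ih =>
      have hfree (γ : Ordinal.{u}) (hγ : γ < p.len) (hγδ : γ < 2 * δ) :
          p.move γ hγ ≠ F b δ := by
        have hdiv : γ / 2 < δ := (Ordinal.lt_mul_iff_div_lt two_ne).1 hγδ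
        have hγ2 : 2 * (γ / 2) + γ % 2 = γ := Ordinal.div_add_mod γ 2
        have hmod : γ % 2 < 2 := Ordinal.mod_lt γ two_ne
        have h01 : γ % 2 = 0 ∨ γ % 2 = 1 := by
          refine Order.le_one_iff.1 (Order.lt_add_one_iff.1 ?_)
          rwa [one_add_one_eq_two]
        generalize γ / 2 = ε at *
        rcases h01 with h | h
        · rw [h, add_zero] at hγ2
          subst hγ2
          obtain ⟨h', hmove⟩ := ih ε hdiv (hdiv.trans hδ)
          rw [hmove]
          exact hmaker b δ hδ ε hdiv
        · rw [h] at hγ2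
          subst hγ2
          have : b ε = p.move _ hγ := dif_pos hγ
          rw [← this]
          exact hbreaker b δ hδ ε hdiv
      have hlen : 2 * δ < p.len := by
        by_contra! hle
        obtain ⟨γ, hγ, h⟩ := p.complete _ (hmem b δ hδ)
        exact hfree γ hγ (hγ.trans_le hle) h
      refine ⟨hlen, ?_⟩
      rw [hp _ hlen (Ordinal.mul_mod _ _)]
      have hF : F (breaker (2 * δ) fun β hβ => p.move β (hβ.trans hlen)) (2 * δ / 2) = F b δ := by
        rw [Ordinal.mul_div_cancel _ two_ne]
        refine hcausal _ _ _ fun ε hε => ?_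
        simp only [b, breaker]
        rw [dif_pos (hround hε), dif_pos ((hround hε).trans hlen)]
      simp only [σ, hF]
      exact if_pos ⟨hmem b δ hδ, fun β hβ => hfree β (hβ.trans hlen) hβ⟩
    obtain ⟨f, hf⟩ := hcopy b
    refine ⟨(SimpleGraph.Hom.ofLE (SimpleGraph.fromEdgeSet_mono ?_)).comp f, hf⟩
    rintro _ ⟨δ, hδ, rfl⟩
    obtain ⟨h, hmove⟩ := hplay δ hδ
    exact ⟨_, h, Ordinal.mul_mod _ _, hmove⟩

/-- Let `κ` be an uncountable cardinal carrying a `κ`-complete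
nonprincipal ultrafilter (i.e. `κ` is measurable).  Then Maker has a winning
strategy in the Maker–Breaker game `MB(K_κ, K_κ)`. -/
theorem makerWins_complete_of_measurable
    (κ : Cardinal.{u}) (hκ : ℵ₀ < κ) (V : Type u) (hV : #V = κ)
    (U : Ultrafilter V)
    (hcomplete : ∀ s : Set (Set V), #s < κ → (∀ A ∈ s, A ∈ U) → ⋂₀ s ∈ U)
    (hfree : ∀ A : Set V, A.Finite → A ∉ U) :
    MakerWins (⊤ : SimpleGraph V) (⊤ : SimpleGraph V) := by
  have hinf : ℵ₀ ≤ κ := hκ.le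
  have : Nonempty V := by
    rw [← Cardinal.mk_ne_zero_iff, hV]
    exact (Cardinal.aleph0_pos.trans hκ).ne'
  obtain ⟨W, hcausal, hW⟩ := Walk.exists_isGood hinf hV (Classical.arbitrary V)
  refine makerWins_of_rule κ.ord (fun b δ => s((W b).walker δ, (W b).target δ)) ?_ ?_ ?_ ?_ ?_
  · intro b b' δ h
    simp only [hcausal b b' δ h]
  · intro b δ hδ
    rw [SimpleGraph.mem_edgeSet, SimpleGraph.top_adj]
    exact ((hW b).target_spec hδ).1.symm
  · exact fun b δ hδ ε hε => (hW b).edge_ne_edge hε hδ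
  · exact fun b δ hδ ε hε => (hW b).edge_ne_breaker hε hδ
  · intro b
    obtain ⟨f, hf, hedge⟩ := (hW b).exists_clique hinf hV U hcomplete hfree
    refine ⟨⟨f, fun {x y} hxy => ?_⟩, hf⟩
    rw [SimpleGraph.fromEdgeSet_adj]
    exact ⟨hedge x y hxy, hf.ne hxy⟩
end

section
/- Let κ be either ω or an uncountable cardinal carrying a κ-complete nonprincipal ultrafilter, and let k be a positive natural number. In the biased Maker-Breaker game on K_κ in which every turn begins with Breaker claiming k previously unclaimed edges (or all remaining edges if fewer than k remain) after which Maker claims one previously unclaimed edge, Maker has a strategy ensuring that at the end of the game her claimed edges contain a copy of K_κ. -/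
open Cardinal

universe u v

/-- In the `k`-biased Maker–Breaker game in which every turn begins with
Breaker claiming `k` edges after which Maker claims one, the moves are indexed
by ordinals in blocks of length `k + 1`: Maker moves at the positions `γ` with
`γ % (k + 1) = k` (the last position of each block). -/
def biasedMakerTurn (k : ℕ) (γ : Ordinal.{u}) : Prop :=
  γ % ((k : Ordinal.{u}) + 1) = (k : Ordinal.{u})

/-- The positions at which Breaker moves in the `k`-biased Maker–Breaker game:
the first `k` positions of each block of length `k + 1`.  In particular
position `0` and all limit positions are Breaker's, so Breaker moves first in
every turn. -/
def biasedBreakerTurn (k : ℕ) (γ : Ordinal.{u}) : Prop :=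
  γ % ((k : Ordinal.{u}) + 1) < (k : Ordinal.{u})

/-- `U` is a nonprincipal ultrafilter closed under intersections of fewer than `κ` members. -/
structure Ultrafilter.IsCompleteFree {V : Type u} (U : Ultrafilter V) (κ : Cardinal.{u}) : Prop where
  sInter_mem : ∀ s : Set (Set V), #s < κ → (∀ A ∈ s, A ∈ U) → ⋂₀ s ∈ U
  finite_notMem : ∀ A : Set V, A.Finite → A ∉ U

namespace Ultrafilter.IsCompleteFree

variable {V W : Type u} {U : Ultrafilter V} {κ : Cardinal.{u}}

theorem biInter_mem (hU : U.IsCompleteFree κ) {ι : Type u} {C : Set ι} (hC : #C < κ)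
    {F : ι → Set V} (hF : ∀ i ∈ C, F i ∈ U) : (⋂ i ∈ C, F i) ∈ U := by
  rw [← Set.sInter_image]
  refine hU.sInter_mem _ (mk_image_le.trans_lt hC) ?_
  rintro _ ⟨i, hi, rfl⟩
  exact hF i hi

theorem exists_mem_of_biUnion_mem (hU : U.IsCompleteFree κ) {ι : Type u} {C : Set ι}
    (hC : #C < κ) {F : ι → Set V} (hF : (⋃ i ∈ C, F i) ∈ U) : ∃ i ∈ C, F i ∈ U := by
  by_contra! h
  have := hU.biInter_mem hC (F := fun i => (F i)ᶜ)
    fun i hi => Ultrafilter.compl_mem_iff_notMem.2 (h i hi)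
  rw [← Set.compl_iUnion₂, Ultrafilter.compl_mem_iff_notMem] at this
  exact this hF

theorem notMem_of_mk_lt (hU : U.IsCompleteFree κ) {A : Set V} (hA : #A < κ) : A ∉ U := by
  intro h
  obtain ⟨a, -, ha⟩ := hU.exists_mem_of_biUnion_mem hA (F := fun a => {a}) (by simpa using h)
  exact hU.finite_notMem _ (Set.finite_singleton a) ha

theorem two_power_lt (hU : U.IsCompleteFree κ) (hV : #V = κ) {μ : Cardinal.{u}} (hμ : μ < κ) :
    2 ^ μ < κ := by
  by_contra! h
  induction μ using Cardinal.inductionOn with | _ M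
  rw [← hV, ← mk_set, Cardinal.le_def] at h
  obtain ⟨g⟩ := h
  have key : ∀ m : M, ∃ A ∈ U, ∀ x ∈ A, ∀ y ∈ A, m ∈ g x ↔ m ∈ g y := by
    intro m
    rcases U.mem_or_compl_mem {x | m ∈ g x} with h | h
    · exact ⟨_, h, fun x hx y hy => iff_of_true hx hy⟩
    · exact ⟨_, h, fun x hx y hy => iff_of_false hx hy⟩
  choose A hA hAg using key
  refine hU.finite_notMem _ (Set.Subsingleton.finite ?_)
    (hU.biInter_mem (C := Set.univ) (by simpa using hμ) fun m _ => hA m)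
  intro x hx y hy
  simp only [Set.mem_univ, Set.iInter_true, Set.mem_iInter] at hx hy
  exact g.injective (Set.ext fun m => hAg m x (hx m) y (hy m))

theorem map (hU : U.IsCompleteFree κ) {f : V → W} (hf : Function.Injective f) :
    (U.map f).IsCompleteFree κ where
  sInter_mem s hs h := by
    rw [Ultrafilter.mem_map, Set.preimage_sInter]
    exact hU.biInter_mem hs fun A hA => h A hA
  finite_notMem A hA h := hU.finite_notMem _ (hA.preimage hf.injOn) h

/-- If `N x` is the chain of predecessors of `x` in a tree order on a large set `P` and fewer than
`κ` members of `P` sit directly on top of each short chain, then the points below almost all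
others form a long branch. -/
theorem le_mk_branch (hU : U.IsCompleteFree κ) {N : V → Set V} {P : Set V} (hP : P ∈ U)
    (hNP : ∀ x, N x ⊆ P) (irrefl : ∀ x, x ∉ N x) (trans : ∀ x, ∀ y ∈ N x, N y ⊆ N x)
    (total : ∀ x, ∀ y ∈ N x, ∀ z ∈ N x, y ≠ z → y ∈ N z ∨ z ∈ N y)
    (exists_min : ∀ x B, ¬ N x ⊆ B → ∃ y ∈ N x, y ∉ B ∧ N y ⊆ B)
    (small : ∀ A : Set V, #A < κ → #{x | x ∈ P ∧ N x = A} < κ) :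
    κ ≤ #{y | {x | y ∈ N x} ∈ U} := by
  set B := {y | {x | y ∈ N x} ∈ U} with hBdef
  by_contra! hB
  have hD : (⋂ b ∈ B, {x | b ∈ N x}) ∈ U := hU.biInter_mem hB fun b hb => hb
  have hE : {x | x ∈ P ∧ N x = B}ᶜ ∈ U :=
    Ultrafilter.compl_mem_iff_notMem.2 (hU.notMem_of_mk_lt (small B hB))
  have hcover : (⋃ y ∈ {x | x ∈ P ∧ N x = B}, {x | y ∈ N x}) ∈ U := by
    filter_upwards [hD, hE, hP] with x hxD hxE hxP
    simp only [Set.mem_iInter, Set.mem_ofPred_eq] at hxD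
    have hne : ¬ N x ⊆ B := fun h => hxE ⟨hxP, h.antisymm hxD⟩
    obtain ⟨y, hy, hyB, hyN⟩ := exists_min x B hne
    refine Set.mem_biUnion (x := y) ⟨hNP x hy, hyN.antisymm fun b hb => ?_⟩ hy
    rcases total x b (hxD b hb) y hy (fun h => hyB (h ▸ hb)) with h | h
    · exact h
    · exact absurd (Filter.mem_of_superset hb fun z hz => trans z b hz h) hyB
  obtain ⟨y, ⟨-, hyN⟩, hy⟩ := hU.exists_mem_of_biUnion_mem (small B hB) hcover
  exact irrefl y (hyN.symm ▸ hy : y ∈ N y)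

end Ultrafilter.IsCompleteFree

theorem Cardinal.mk_lt_of_initial_segments_le {X T : Type u} [LinearOrder T] {κ μ μ' : Cardinal.{u}}
    (hκ : ℵ₀ ≤ κ) (hμ : μ < μ') (hμ' : μ' < κ) {S : Set X} {f : X → T} (hf : S.InjOn f)
    (h : ∀ x ∈ S, #{y | y ∈ S ∧ f y < f x} ≤ μ) : #S < κ := by
  by_contra! hS
  obtain ⟨W, hWS, hW⟩ := le_mk_iff_exists_subset.1 (hμ'.le.trans hS)
  have hcover : S ⊆ ⋃ w ∈ W, insert w {y | y ∈ S ∧ f y < f w} := by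
    intro x hx
    by_contra hxW
    simp only [Set.mem_iUnion, not_exists, Set.mem_insert_iff, Set.mem_ofPred_eq, not_or, not_and,
      not_lt] at hxW
    have : W ⊆ {y | y ∈ S ∧ f y < f x} := fun w hw =>
      ⟨hWS hw, ((hxW w hw).2 hx).lt_of_ne fun e => (hxW w hw).1 (hf (hWS hw) hx e).symm⟩
    exact (hW ▸ mk_le_mk_of_subset this).not_gt ((h x hx).trans_lt hμ)
  have hle : #S ≤ μ' * (μ + 1) := by
    refine (mk_le_mk_of_subset hcover).trans ((mk_biUnion_le _ _).trans ?_)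
    rw [hW]
    gcongr
    exact ciSup_le' fun w => mk_insert_le.trans (add_le_add_left (h w (hWS w.2)) 1)
  exact (hS.trans hle).not_gt (mul_lt_of_lt hκ hμ'
    (add_lt_of_lt hκ (hμ.trans hμ') (one_lt_aleph0.trans_le hκ)))

namespace CliqueGame

variable {V T : Type u} [LinearOrder T]

/-- All moves of `d` immediately before time `t` are made at the vertex `v`. -/
def IsActive (d : T → V × V) (t : T) (v : V) : Prop :=
  ∃ s < t, ∀ u < t, s ≤ u → (d u).1 = v

/-- The vertices to which `v` has been linked before time `t`. -/
def targets (d : T → V × V) (t : T) (v : V) : Set V :=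
  {w | ∃ s < t, d s = (v, w)}

/-- The vertices to which `v` is ever linked. -/
def links (d : T → V × V) (v : V) : Set V :=
  {w | ∃ s, d s = (v, w)}

/-- The move `q` links the active vertex to an available vertex lying directly on top of the chain
climbed so far. -/
def Extends (C : Set (Sym2 V)) (active : V → Prop) (N : V → Set V) (q : V × V) : Prop :=
  active q.1 ∧ q.2 ≠ q.1 ∧ N q.2 = N q.1 ∧ s(q.1, q.2) ∉ C

/-- The move `q` links an untouched vertex to the root `r`. -/
def Starts (r : V) (C : Set (Sym2 V)) (q : V × V) : Prop :=
  q.2 = r ∧ q.1 ≠ r ∧ ∀ w, s(q.1, w) ∉ C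

open Classical in
/-- Maker's preferred move: let the active vertex climb further, or else start a new vertex. -/
noncomputable def step (r : V) (C : Set (Sym2 V)) (active : V → Prop) (N : V → Set V) : V × V :=
  if h : ∃ q, Extends C active N q then h.choose
  else if h : ∃ q, Starts r C q then h.choose else (r, r)

/-- Maker's moves, computed from the sets `C t` of edges claimed before time `t`. -/
noncomputable def run [WellFoundedLT T] (r : V) (C : T → Set (Sym2 V)) (t : T) : V × V :=
  step r (C t) (fun v => ∃ s, ∃ _ : s < t, ∀ u, ∀ _ : u < t, s ≤ u → (run r C u).1 = v)
    (fun v => {w | ∃ s, ∃ _ : s < t, run r C s = (v, w)})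
termination_by wellFounded_lt.wrap t
decreasing_by all_goals assumption

theorem run_eq [WellFoundedLT T] (r : V) (C : T → Set (Sym2 V)) (t : T) :
    run r C t = step r (C t) (IsActive (run r C) t) (targets (run r C) t) := by
  rw [run]
  simp only [exists_prop]
  rfl

theorem run_congr [WellFoundedLT T] (r : V) {C C' : T → Set (Sym2 V)} (t : T)
    (h : ∀ s ≤ t, C s = C' s) : run r C t = run r C' t := by
  induction t using WellFoundedLT.induction with | ind t ih
  have ih' : ∀ s < t, run r C s = run r C' s := fun s hs =>
    ih s hs fun u hu => h u (hu.trans hs.le)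
  have h1 : IsActive (run r C) t = IsActive (run r C') t := by
    funext v
    refine propext (exists_congr fun s => and_congr_right fun _ => forall₂_congr fun u hu => ?_)
    rw [ih' u hu]
  have h2 : targets (run r C) t = targets (run r C') t := by
    funext v
    refine Set.ext fun w => exists_congr fun s => and_congr_right fun hs => ?_
    rw [ih' s hs]
  rw [run_eq, run_eq r C', h t le_rfl, h1, h2]

/-- The moves `d` are made according to Maker's rule while the sets `C t` of claimed edges grow. -/
structure IsRun (r : V) (C : T → Set (Sym2 V)) (d : T → V × V) : Prop where
  claimed : ∀ s t, s < t → s((d s).1, (d s).2) ∈ C t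
  move : ∀ t, Extends (C t) (IsActive d t) (targets d t) (d t) ∨
    (∀ q, ¬ Extends (C t) (IsActive d t) (targets d t) q) ∧ Starts r (C t) (d t)

theorem run_spec [WellFoundedLT T] {r : V} {C : T → Set (Sym2 V)} {t : T}
    (hstart : ∃ q, Starts r (C t) q) :
    Extends (C t) (IsActive (run r C) t) (targets (run r C) t) (run r C t) ∨
      (∀ q, ¬ Extends (C t) (IsActive (run r C) t) (targets (run r C) t) q) ∧
        Starts r (C t) (run r C t) := by
  by_cases h : ∃ q, Extends (C t) (IsActive (run r C) t) (targets (run r C) t) q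
  · left
    rw [run_eq, step, dif_pos h]
    exact h.choose_spec
  · right
    refine ⟨not_exists.1 h, ?_⟩
    rw [run_eq, step, dif_neg h, dif_pos hstart]
    exact hstart.choose_spec

theorem exists_starts {κ : Cardinal.{u}} (hκ : ℵ₀ ≤ κ) (hV : #V = κ) (r : V) {E : Set (Sym2 V)}
    (hE : #E < κ) : ∃ q, Starts r E q := by
  by_contra! h
  have hcover : (Set.univ : Set V) ⊆ insert r (⋃ e ∈ E, {v | v ∈ e}) := by
    intro v _
    by_cases hv : v = r
    · exact Or.inl hv
    · right
      have := h (v, r)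
      simp only [Starts, true_and, not_and, not_forall, not_not] at this
      obtain ⟨w, hw⟩ := this hv
      exact Set.mem_biUnion hw (Sym2.mem_mk_left v w)
  have hle : κ ≤ #E * 2 + 1 := by
    rw [← hV, ← mk_univ]
    refine (mk_le_mk_of_subset hcover).trans (mk_insert_le.trans
      (add_le_add_left ((mk_biUnion_le _ _).trans ?_) 1))
    gcongr
    refine ciSup_le' fun ⟨e, _⟩ => ?_
    induction e using Sym2.ind with | _ a b
    have : {v | v ∈ s(a, b)} = {a, b} := by
      ext v
      simp
    simp only [this]
    refine mk_insert_le.trans ?_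
    rw [mk_singleton, one_add_one_eq_two]
  refine hle.not_gt (add_lt_of_lt hκ (mul_lt_of_lt hκ hE ?_) (one_lt_aleph0.trans_le hκ))
  exact_mod_cast (natCast_lt_aleph0 (n := 2)).trans_le hκ

theorem IsActive.unique {d : T → V × V} {t : T} {v w : V} (hv : IsActive d t v)
    (hw : IsActive d t w) : v = w := by
  obtain ⟨s, hs, h⟩ := hv
  obtain ⟨s', hs', h'⟩ := hw
  rw [← h _ (max_lt hs hs') (le_max_left _ _), h' _ (max_lt hs hs') (le_max_right _ _)]

namespace IsRun

variable {r : V} {C : T → Set (Sym2 V)} {d : T → V × V}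

theorem notMem (hd : IsRun r C d) (t : T) : s((d t).1, (d t).2) ∉ C t := by
  rcases hd.move t with h | ⟨-, h⟩
  · exact h.2.2.2
  · exact h.2.2 _

theorem ne (hd : IsRun r C d) (t : T) : (d t).2 ≠ (d t).1 := by
  rcases hd.move t with h | ⟨-, h⟩
  · exact h.2.1
  · rw [h.1]
    exact h.2.1.symm

theorem injective (hd : IsRun r C d) : Function.Injective d := by
  intro s t h
  by_contra hne
  rcases lt_or_gt_of_ne hne with hlt | hlt
  · exact hd.notMem t (h ▸ hd.claimed s t hlt)
  · exact hd.notMem s (h ▸ hd.claimed t s hlt)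

theorem fst_ne_of_starts (hd : IsRun r C d) {s t : T} (h : Starts r (C t) (d t)) (hst : s < t) :
    (d s).1 ≠ (d t).1 := by
  intro e
  have := hd.claimed s t hst
  rw [e] at this
  exact h.2.2 _ this

theorem active_or_starts (hd : IsRun r C d) (t : T) :
    IsActive d t (d t).1 ∨ Starts r (C t) (d t) :=
  (hd.move t).imp (·.1) (·.2)

theorem targets_subset_links (t : T) (v : V) : targets d t v ⊆ links d v :=
  fun _ ⟨s, _, hs⟩ => ⟨s, hs⟩

theorem notMem_links_self (hd : IsRun r C d) (v : V) : v ∉ links d v :=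
  fun ⟨s, hs⟩ => hd.ne s (by rw [hs])

theorem mk_le_mk_links (hd : IsRun r C d) {v : V} {I : Set T} (hI : ∀ u ∈ I, (d u).1 = v) :
    #I ≤ #(links d v) := by
  refine mk_le_of_injective (f := fun u : I => (⟨(d u).2, u, Prod.ext (hI u u.2) rfl⟩ : links d v))
    fun u w h => Subtype.ext (hd.injective (Prod.ext ?_ (congrArg Subtype.val h)))
  rw [hI u u.2, hI w w.2]

variable [WellFoundedLT T]

theorem fst_eq_of_le_of_le (hd : IsRun r C d) {x : V} {s t u : T} (hs : (d s).1 = x)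
    (hu : (d u).1 = x) (hst : s ≤ t) (htu : t ≤ u) : (d t).1 = x := by
  induction u using WellFoundedLT.induction with | ind u ih
  rcases htu.eq_or_lt with rfl | htu
  · exact hu
  rcases hd.active_or_starts u with ⟨s', hs', h⟩ | h
  · rw [hu] at h
    rcases le_total s' t with hle | hle
    · exact h t htu hle
    · exact ih s' hs' (h s' hs' le_rfl) hle
  · exact absurd (hs.trans hu.symm) (hd.fst_ne_of_starts h (hst.trans_lt htu))

theorem fst_ne_root (hd : IsRun r C d) (t : T) : (d t).1 ≠ r := by
  induction t using WellFoundedLT.induction with | ind t ih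
  rcases hd.active_or_starts t with ⟨s, hs, h⟩ | h
  · exact h s hs le_rfl ▸ ih s hs
  · exact h.2.1

theorem links_root (hd : IsRun r C d) : links d r = ∅ :=
  Set.eq_empty_of_forall_notMem fun _ ⟨s, hs⟩ => hd.fst_ne_root s (by rw [hs])

theorem links_eq_targets_of_active (hd : IsRun r C d) {t : T} {v w : V} (hv : IsActive d t v)
    (hne : w ≠ v) (hw : (targets d t w).Nonempty) : links d w = targets d t w := by
  refine (targets_subset_links t w).antisymm' fun x ⟨s, hs⟩ => ⟨s, ?_, hs⟩
  obtain ⟨y, u, hut, hu⟩ := hw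
  obtain ⟨b, hbt, hb⟩ := hv
  by_contra! hts
  refine hne ?_
  rw [← hb (max b u) (max_lt hbt hut) (le_max_left _ _)]
  exact (hd.fst_eq_of_le_of_le (x := w) (by rw [hu]) (by rw [hs]) (le_max_right _ _)
    ((max_lt hbt hut).le.trans hts)).symm

/-- A vertex to which `v` gets linked has as its chain precisely the chain of `v` so far. -/
theorem links_snd (hd : IsRun r C d) {t : T} {v w : V} (h : d t = (v, w)) :
    links d w = targets d t v := by
  rcases hd.move t with hm | ⟨-, hm⟩
  · rw [h] at hm
    obtain ⟨hact, hne, heq, -⟩ := hm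
    dsimp only at hact hne heq
    rw [← heq]
    refine hd.links_eq_targets_of_active hact hne ?_
    rw [heq]
    obtain ⟨s, hs, hsv⟩ := hact
    exact ⟨(d s).2, s, hs, by rw [← hsv s hs le_rfl]⟩
  · have hv : targets d t v = ∅ := Set.eq_empty_of_forall_notMem fun x ⟨s, hst, hs⟩ =>
      hd.fst_ne_of_starts hm hst (by rw [hs, h])
    rw [h] at hm
    rw [hv, show w = r from hm.1, hd.links_root]

theorem links_subset_of_mem (hd : IsRun r C d) (v : V) : ∀ w ∈ links d v, links d w ⊆ links d v :=
  fun _ ⟨_, hs⟩ => hd.links_snd hs ▸ targets_subset_links _ _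

theorem links_total (hd : IsRun r C d) (v : V) :
    ∀ x ∈ links d v, ∀ y ∈ links d v, x ≠ y → x ∈ links d y ∨ y ∈ links d x := by
  rintro x ⟨s, hs⟩ y ⟨t, ht⟩ hxy
  rw [hd.links_snd hs, hd.links_snd ht]
  rcases lt_trichotomy s t with h | rfl | h
  · exact Or.inl ⟨s, h, hs⟩
  · exact absurd (congrArg Prod.snd (hs.symm.trans ht)) hxy
  · exact Or.inr ⟨t, h, ht⟩

theorem exists_min_link (hd : IsRun r C d) (v : V) (B : Set V) (h : ¬ links d v ⊆ B) :
    ∃ w ∈ links d v, w ∉ B ∧ links d w ⊆ B := by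
  obtain ⟨w, ⟨s, hs⟩, hw⟩ := Set.not_subset.1 h
  obtain ⟨t, ⟨w, ht, hwB⟩, hmin⟩ := (wellFounded_lt (α := T)).has_min
    {t | ∃ w, d t = (v, w) ∧ w ∉ B} ⟨s, w, hs, hw⟩
  refine ⟨w, ⟨t, ht⟩, hwB, ?_⟩
  rw [hd.links_snd ht]
  rintro x ⟨u, hut, hu⟩
  by_contra hx
  exact hmin u ⟨x, hu, hx⟩ hut

theorem exists_start (hd : IsRun r C d) {v : V} (h : (links d v).Nonempty) :
    ∃ t, (d t).1 = v ∧ ∀ w, s(v, w) ∉ C t := by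
  obtain ⟨w, s, hs⟩ := h
  obtain ⟨t, ht, hmin⟩ := (wellFounded_lt (α := T)).has_min {t | (d t).1 = v} ⟨s, by simp [hs]⟩
  refine ⟨t, ht, ?_⟩
  rcases hd.active_or_starts t with ⟨u, hu, h⟩ | h
  · exact absurd hu (hmin u ((h u hu le_rfl).trans ht))
  · rw [← show (d t).1 = v from ht]
    exact h.2.2

variable {κ : Cardinal.{u}} {k : ℕ}

/-- A vertex with a short chain stops climbing. -/
theorem exists_end (hd : IsRun r C d) (hκ : ℵ₀ ≤ κ) (hT : #T = κ)
    (hIio : ∀ t : T, #(Set.Iio t) < κ) {v : V} (hv : #(links d v) < κ) {s : T}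
    (hs : (d s).1 = v) : ∃ t, s < t ∧ (d t).1 ≠ v ∧ ∀ u < t, s ≤ u → (d u).1 = v := by
  have hex : ∃ t, s < t ∧ (d t).1 ≠ v := by
    by_contra! h
    have h1 : #(Set.Ici s) ≤ #(links d v) := hd.mk_le_mk_links fun u hu =>
      (show s ≤ u from hu).eq_or_lt.elim (fun e => e ▸ hs) (h u)
    have h2 : κ ≤ #(Set.Iio s) + #(Set.Ici s) := by
      rw [← hT, ← mk_univ, ← Set.Iio_union_Ici (a := s)]
      exact mk_union_le _ _
    exact h2.not_gt (add_lt_of_lt hκ (hIio s) (h1.trans_lt hv))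
  obtain ⟨t, ⟨hst, ht⟩, hmin⟩ := (wellFounded_lt (α := T)).has_min {t | s < t ∧ (d t).1 ≠ v} hex
  refine ⟨t, hst, ht, fun u hut hsu => ?_⟩
  by_contra hu
  exact hmin u ⟨hsu.lt_of_ne fun e => hu (e ▸ hs), hu⟩ hut

/-- The edges joining `v` to the vertices with the same chain that were started earlier have all
been claimed while `v` was climbing. -/
theorem mk_earlier_le (hd : IsRun r C d) (hκ : ℵ₀ ≤ κ) (hT : #T = κ)
    (hIio : ∀ t : T, #(Set.Iio t) < κ)
    (hC : ∀ s t, #(C t \ C s : Set (Sym2 V)) ≤ #(Set.Icc s t) * (k + 1))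
    {v : V} {s : T} (hs : (d s).1 = v) (hfresh : ∀ w, s(v, w) ∉ C s) (hv : #(links d v) < κ) :
    #{w | links d w = links d v ∧ ∃ u < s, (d u).1 = w} ≤ (#(links d v) + 1) * (k + 1) := by
  obtain ⟨t, hst, ht, htv⟩ := hd.exists_end hκ hT hIio hv hs
  have hact : IsActive d t v := ⟨s, hst, htv⟩
  have hlt : ∀ u, (d u).1 = v → u < t := fun u hu => lt_of_not_ge fun h =>
    ht (hd.fst_eq_of_le_of_le hs hu hst.le h)
  have hvt : links d v = targets d t v :=
    (targets_subset_links t v).antisymm' fun w ⟨u, hu⟩ => ⟨u, hlt u (by rw [hu]), hu⟩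
  have hno : ∀ q, ¬ Extends (C t) (IsActive d t) (targets d t) q :=
    (hd.move t).elim (fun h => absurd (h.1.unique hact) ht) (·.1)
  have himage : (fun w => s(v, w)) '' {w | links d w = links d v ∧ ∃ u < s, (d u).1 = w} ⊆
      C t \ C s := by
    rintro _ ⟨w, ⟨hw, u, hus, hu⟩, rfl⟩
    refine ⟨?_, hfresh w⟩
    by_contra hmem
    have hne : w ≠ v := by
      rintro rfl
      apply hfresh (d u).2
      have := hd.claimed u s hus
      rwa [hu] at this
    refine hno (v, w) ⟨hact, hne, ?_, hmem⟩
    rw [← hd.links_eq_targets_of_active hact hne ⟨(d u).2, u, hus.trans hst, by rw [← hu]⟩, hw,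
      hvt]
  have hIcc : #(Set.Icc s t) ≤ #(links d v) + 1 := by
    rw [← Set.Ico_insert_right hst.le]
    refine mk_insert_le.trans (add_le_add_left (hd.mk_le_mk_links fun u hu => ?_) 1)
    exact htv u hu.2 hu.1
  calc #{w | links d w = links d v ∧ ∃ u < s, (d u).1 = w}
      = #((fun w => s(v, w)) '' {w | links d w = links d v ∧ ∃ u < s, (d u).1 = w}) :=
        (mk_image_eq fun _ _ h => Sym2.congr_right.1 h).symm
    _ ≤ #(C t \ C s : Set (Sym2 V)) := mk_le_mk_of_subset himage
    _ ≤ #(Set.Icc s t) * (k + 1) := hC s t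
    _ ≤ _ := by gcongr

theorem mk_links_eq_lt (hd : IsRun r C d) {U : Ultrafilter V} (hU : U.IsCompleteFree κ)
    (hκ : ℵ₀ ≤ κ) (hV : #V = κ) (hT : #T = κ) (hIio : ∀ t : T, #(Set.Iio t) < κ)
    (hC : ∀ s t, #(C t \ C s : Set (Sym2 V)) ≤ #(Set.Icc s t) * (k + 1))
    {A : Set V} (hAne : A.Nonempty) (hA : #A < κ) : #{v | links d v = A} < κ := by
  have hstart : ∀ v, links d v = A → ∃ t, (d t).1 = v ∧ ∀ w, s(v, w) ∉ C t :=
    fun v hv => hd.exists_start (hv ▸ hAne)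
  have : Nonempty T := mk_ne_zero_iff.1 (hT ▸ (aleph0_pos.trans_le hκ).ne')
  choose! f hf hfresh using hstart
  have hμ : (#A + 1) * (k + 1) < κ := mul_lt_of_lt hκ
    (add_lt_of_lt hκ hA (one_lt_aleph0.trans_le hκ))
    (by exact_mod_cast (natCast_lt_aleph0 (n := k + 1)).trans_le hκ)
  refine Cardinal.mk_lt_of_initial_segments_le hκ (cantor _) (hU.two_power_lt hV hμ) (f := f)
    (fun v hv w hw h => (hf v hv).symm.trans (h ▸ hf w hw)) fun v hv => ?_
  have hv' : links d v = A := hv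
  have h := hd.mk_earlier_le hκ hT hIio hC (hf v hv) (hfresh v hv) (hv' ▸ hA)
  rw [hv'] at h
  refine (mk_le_mk_of_subset ?_).trans h
  exact fun w hw => ⟨hw.1, f w, hw.2, hf w hw.1⟩

/-- Maker's edges contain a large clique. -/
theorem exists_clique (hd : IsRun r C d) {U : Ultrafilter V} (hU : U.IsCompleteFree κ)
    (hκ : ℵ₀ ≤ κ) (hV : #V = κ) (hT : #T = κ) (hIio : ∀ t : T, #(Set.Iio t) < κ)
    (hC : ∀ s t, #(C t \ C s : Set (Sym2 V)) ≤ #(Set.Icc s t) * (k + 1)) :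
    ∃ B : Set V, κ ≤ #B ∧ ∀ x ∈ B, ∀ y ∈ B, x ≠ y → x ∈ links d y ∨ y ∈ links d x := by
  by_cases hbig : ∃ v, κ ≤ #(links d v)
  · obtain ⟨v, hv⟩ := hbig
    exact ⟨links d v, hv, hd.links_total v⟩
  push Not at hbig
  set P : Set V := {v | v = r ∨ (links d v).Nonempty} with hP
  have hfst : ∀ t, (d t).1 ∈ P := fun t => Or.inr ⟨(d t).2, t, rfl⟩
  have hsnd : ∀ t, (d t).2 ∈ P := by
    intro t
    by_cases h : (links d (d t).2).Nonempty
    · exact Or.inr h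
    · left
      rcases hd.move t with hm | ⟨-, hm⟩
      · obtain ⟨⟨s, hs, hsv⟩, -, heq, -⟩ := hm
        refine absurd ?_ h
        have : (d s).2 ∈ targets d t (d t).1 := ⟨s, hs, by rw [← hsv s hs le_rfl]⟩
        exact ⟨_, targets_subset_links t _ (heq ▸ this)⟩
      · exact hm.1
  have hPκ : #P = κ := by
    refine ((mk_set_le P).trans hV.le).antisymm ?_
    by_contra! hlt
    refine (mul_lt_of_lt hκ hlt hlt).not_ge ?_
    rw [← hT, mul_def]
    exact mk_le_of_injective (f := fun t => ((⟨_, hfst t⟩, ⟨_, hsnd t⟩) : P × P))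
      fun s t h => hd.injective (by simpa [Prod.ext_iff] using h)
  obtain ⟨e⟩ := Cardinal.eq.1 (hV.trans hPκ.symm)
  have hf : Function.Injective fun v => (e v : V) := Subtype.val_injective.comp e.injective
  have hPU : P ∈ U.map fun v => (e v : V) := by
    rw [Ultrafilter.mem_map, Set.eq_univ_of_forall (s := _ ⁻¹' P) fun v => (e v).2]
    exact Filter.univ_mem
  refine ⟨_, (hU.map hf).le_mk_branch hPU (N := links d) ?_ hd.notMem_links_self
    hd.links_subset_of_mem hd.links_total hd.exists_min_link ?_, ?_⟩
  · rintro x y ⟨t, ht⟩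
    simpa [ht] using hsnd t
  · intro A hA
    rcases A.eq_empty_or_nonempty with rfl | hne
    · refine (mk_le_mk_of_subset (t := {r}) ?_).trans_lt
        ((mk_singleton r).trans_lt (one_lt_aleph0.trans_le hκ))
      rintro x ⟨rfl | hx, hx'⟩
      · rfl
      · exact absurd hx' hx.ne_empty
    · exact (mk_le_mk_of_subset fun x hx => hx.2).trans_lt
        (hd.mk_links_eq_lt hU hκ hV hT hIio hC hne hA)
  · intro x hx y hy hxy
    obtain ⟨z, hzx, hzy⟩ := Ultrafilter.nonempty_of_mem (Filter.inter_mem hx hy)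
    exact hd.links_total (e z) x hzx y hzy hxy

end IsRun

section Strategy

variable {V : Type u} {k : ℕ} {o : Ordinal.{u}}

/-- The position of Maker's move in the block with index `t`. -/
noncomputable def makerPosition (k : ℕ) (t : o.ToType) : Ordinal.{u} :=
  ((k : Ordinal.{u}) + 1) * (t.toOrd : Ordinal.{u}) + k

theorem blockLength_ne_zero (k : ℕ) : (k : Ordinal.{u}) + 1 ≠ 0 := by
  exact_mod_cast k.succ_ne_zero

theorem lt_blockLength (k : ℕ) : (k : Ordinal.{u}) < (k : Ordinal.{u}) + 1 := by
  exact_mod_cast k.lt_succ_self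

theorem makerPosition_div (t : o.ToType) :
    makerPosition k t / ((k : Ordinal.{u}) + 1) = t.toOrd := by
  rw [makerPosition, Ordinal.mul_add_div _ (blockLength_ne_zero k),
    Ordinal.div_eq_zero_of_lt (lt_blockLength k), add_zero]

theorem biasedMakerTurn_makerPosition (t : o.ToType) :
    biasedMakerTurn k (makerPosition k t) := by
  rw [biasedMakerTurn, makerPosition, Ordinal.mul_add_mod_self,
    Ordinal.mod_eq_of_lt (lt_blockLength k)]

theorem makerPosition_injective : Function.Injective (makerPosition k : o.ToType → Ordinal.{u}) := by
  intro s t h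
  have := makerPosition_div (k := k) s
  rw [h, makerPosition_div] at this
  exact Ordinal.ToType.mk.symm.injective (Subtype.ext this.symm)

theorem makerPosition_strictMono :
    StrictMono (makerPosition k : o.ToType → Ordinal.{u}) := by
  refine Monotone.strictMono_of_injective (fun s t h => ?_) makerPosition_injective
  have h' : (s.toOrd : Ordinal.{u}) ≤ t.toOrd := Ordinal.ToType.mk.symm.monotone h
  unfold makerPosition
  gcongr

theorem makerPosition_lt_ord {κ : Cardinal.{u}} (hκ : ℵ₀ ≤ κ) (t : κ.ord.ToType) :
    makerPosition k t < κ.ord := by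
  have ht : (t.toOrd : Ordinal.{u}).card < κ := lt_ord.1 t.toOrd.2
  have hn (n : ℕ) : (n : Cardinal.{u}) < κ := natCast_lt_aleph0.trans_le hκ
  rw [lt_ord, makerPosition, Ordinal.card_add, Ordinal.card_mul]
  refine add_lt_of_lt hκ (mul_lt_of_lt hκ ?_ ht) (by simpa using hn k)
  simpa using hn (k + 1)

theorem exists_block {δ : Ordinal.{u}} {t : o.ToType} (h : δ < makerPosition k t) :
    ∃ u ≤ t, (∀ s, makerPosition k s ≤ δ → s ≤ u) ∧
      ∃ i : Fin (k + 1), ((k : Ordinal.{u}) + 1) * (u.toOrd : Ordinal.{u}) + (i : ℕ) = δ := by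
  have hle : δ / ((k : Ordinal.{u}) + 1) ≤ t.toOrd :=
    makerPosition_div (k := k) t ▸ Ordinal.div_le_left h.le _
  have hlt : δ / ((k : Ordinal.{u}) + 1) < o := hle.trans_lt t.toOrd.2
  have hmod := Ordinal.mod_lt δ (blockLength_ne_zero k)
  obtain ⟨i, hi⟩ := Ordinal.lt_omega0.1
    (hmod.trans (by exact_mod_cast Ordinal.natCast_lt_omega0 (k + 1)))
  refine ⟨Ordinal.ToType.mk ⟨_, hlt⟩, ?_, fun s hs => ?_, ⟨i, ?_⟩, ?_⟩
  · rw [← OrderIso.le_symm_apply]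
    exact hle
  · rw [← OrderIso.symm_apply_le]
    exact (makerPosition_div (k := k) s).ge.trans (Ordinal.div_le_left hs _)
  · rw [hi] at hmod
    exact_mod_cast hmod
  · simp only [Ordinal.ToType.toOrd, OrderIso.symm_apply_apply]
    rw [← hi]
    exact Ordinal.div_add_mod _ _

/-- The edges claimed before Maker's move in each block, according to a history of length `γ`. -/
def claimedBefore (k : ℕ) (o γ : Ordinal.{u}) (hist : ∀ β : Ordinal.{u}, β < γ → Sym2 V)
    (t : o.ToType) : Set (Sym2 V) :=
  {e | ∃ δ h, δ < makerPosition k t ∧ hist δ h = e}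

/-- The edge preferred by Maker in the block `t`. -/
noncomputable def preferredEdge (k : ℕ) (r : V) (γ : Ordinal.{u})
    (hist : ∀ β : Ordinal.{u}, β < γ → Sym2 V) (t : o.ToType) : Sym2 V :=
  s((run r (claimedBefore k o γ hist) t).1, (run r (claimedBefore k o γ hist) t).2)

/-- The edge `e` may be claimed after the given history. -/
def IsFree {γ : Ordinal.{u}} (hist : ∀ β : Ordinal.{u}, β < γ → Sym2 V) (e : Sym2 V) : Prop :=
  e ∈ (⊤ : SimpleGraph V).edgeSet ∧ ∀ β h, hist β h ≠ e

open Classical in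
/-- Maker plays the preferred edge as long as this is possible. -/
noncomputable def strategy (k : ℕ) (o : Ordinal.{u}) (r : V) : MBStrategy (Sym2 V) :=
  fun γ hist =>
    if h : ∃ t : o.ToType, makerPosition k t = γ ∧ IsFree hist (preferredEdge k r γ hist t) then
      preferredEdge k r γ hist h.choose
    else if h : ∃ e, IsFree hist e then h.choose else s(r, r)

theorem strategy_isLegal (k : ℕ) (o : Ordinal.{u}) (r : V) (turns : Ordinal.{u} → Prop) :
    (strategy k o r).IsLegal (⊤ : SimpleGraph V).edgeSet turns := by
  intro γ hist _ _ _ hex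
  change IsFree hist (strategy k o r γ hist)
  unfold strategy
  split_ifs with h h'
  · exact h.choose_spec.2
  · exact h'.choose_spec
  · exact absurd hex h'

theorem strategy_makerPosition {r : V} {t : o.ToType}
    {hist : ∀ β : Ordinal.{u}, β < makerPosition k t → Sym2 V}
    (h : IsFree hist (preferredEdge k r _ hist t)) :
    strategy k o r _ hist = preferredEdge k r _ hist t := by
  have hex : ∃ t' : o.ToType, makerPosition k t' = makerPosition k t ∧
    IsFree hist (preferredEdge k r _ hist t') := ⟨t, rfl, h⟩
  rw [strategy, dif_pos hex, makerPosition_injective hex.choose_spec.1]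

theorem mk_le_mk_mul {T : Type u} {E : Set (Sym2 V)} {I : Set T} (g : T → Fin (k + 1) → Sym2 V)
    (h : ∀ e ∈ E, ∃ t ∈ I, ∃ i, g t i = e) : #E ≤ #I * (k + 1) := by
  have hE : E ⊆ Set.range fun x : I × Fin (k + 1) => g x.1 x.2 := by
    intro e he
    obtain ⟨t, ht, i, rfl⟩ := h e he
    exact ⟨(⟨t, ht⟩, i), rfl⟩
  refine (mk_le_mk_of_subset hE).trans (mk_range_le.trans ?_)
  simp

theorem ord_le_len {κ : Cardinal.{u}} (hκ : ℵ₀ ≤ κ) (hV : #V = κ) (r : V)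
    (p : MBPlay (⊤ : SimpleGraph V).edgeSet) : κ.ord ≤ p.len := by
  by_contra! hlt
  have hE : (⊤ : SimpleGraph V).edgeSet ⊆
      Set.range fun x : p.len.ToType => p.move x.toOrd x.toOrd.2 := by
    intro e he
    obtain ⟨γ, h, rfl⟩ := p.complete e he
    exact ⟨Ordinal.ToType.mk ⟨γ, h⟩, by simp⟩
  have hcard : #(⊤ : SimpleGraph V).edgeSet < κ := by
    refine ((mk_le_mk_of_subset hE).trans mk_range_le).trans_lt ?_
    rw [mk_toType]
    exact lt_ord.1 hlt
  obtain ⟨q, -, hne, hq⟩ := exists_starts hκ hV r hcard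
  exact hq r (by simpa using hne)

theorem strategy_wins {κ : Cardinal.{u}} (hκ : ℵ₀ ≤ κ) (hV : #V = κ) {U : Ultrafilter V}
    (hU : U.IsCompleteFree κ) (r : V) (p : MBPlay (⊤ : SimpleGraph V).edgeSet)
    (hp : p.Follows (biasedMakerTurn k) (strategy k κ.ord r)) :
    ContainsCopy (SimpleGraph.fromEdgeSet (p.claimed (biasedMakerTurn k)))
      (⊤ : SimpleGraph V) := by
  have hlen : ∀ t : κ.ord.ToType, makerPosition k t < p.len := fun t =>
    (makerPosition_lt_ord hκ t).trans_le (ord_le_len hκ hV r p)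
  set C := claimedBefore k κ.ord p.len p.move with hC
  classical
  let g : κ.ord.ToType → Fin (k + 1) → Sym2 V := fun t i =>
    if h : ((k : Ordinal.{u}) + 1) * (t.toOrd : Ordinal.{u}) + (i : ℕ) < p.len then p.move _ h
    else s(r, r)
  have hdiff : ∀ s t, #(C t \ C s : Set (Sym2 V)) ≤ #(Set.Icc s t) * (k + 1) := by
    refine fun s t => mk_le_mk_mul g ?_
    rintro _ ⟨⟨δ, h, hδt, rfl⟩, hs⟩
    obtain ⟨u, hut, hsu, i, rfl⟩ := exists_block hδt
    exact ⟨u, ⟨hsu s (le_of_not_gt fun hlt => hs ⟨_, h, hlt, rfl⟩), hut⟩, i, dif_pos h⟩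
  have hIio : ∀ t : κ.ord.ToType, #(Set.Iio t) < κ := fun t => by
    simpa using mk_Iio_lt t (by simp)
  have hsmall : ∀ t, #(C t) < κ := by
    intro t
    refine (mk_le_mk_mul (k := k) (I := Set.Iic t) g ?_).trans_lt (mul_lt_of_lt hκ ?_ ?_)
    · rintro _ ⟨δ, h, hδt, rfl⟩
      obtain ⟨u, hut, -, i, rfl⟩ := exists_block hδt
      exact ⟨u, hut, i, dif_pos h⟩
    · rw [← Set.Iio_insert]
      exact mk_insert_le.trans_lt (add_lt_of_lt hκ (hIio t) (one_lt_aleph0.trans_le hκ))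
    · exact_mod_cast (natCast_lt_aleph0 (n := k + 1)).trans_le hκ
  have hspec := fun t => run_spec (exists_starts hκ hV r (hsmall t))
  have hmove : ∀ t, p.move _ (hlen t) = s((run r C t).1, (run r C t).2) := by
    intro t
    set hist : ∀ β : Ordinal.{u}, β < makerPosition k t → Sym2 V :=
      fun β hβ => p.move β (hβ.trans (hlen t)) with hhist
    have hrun : run r (claimedBefore k κ.ord _ hist) t = run r C t := by
      refine run_congr r t fun s hs => Set.ext fun e => ⟨?_, ?_⟩
      · rintro ⟨δ, h, hδ, he⟩
        exact ⟨δ, _, hδ, he⟩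
      · rintro ⟨δ, h, hδ, he⟩
        exact ⟨δ, hδ.trans_le (makerPosition_strictMono.monotone hs), hδ, he⟩
    have hpref : preferredEdge k r _ hist t = s((run r C t).1, (run r C t).2) := by
      rw [preferredEdge, hrun]
    rw [hp _ (hlen t) (biasedMakerTurn_makerPosition t), ← hpref]
    refine strategy_makerPosition ?_
    rw [hpref]
    have hfree : (run r C t).2 ≠ (run r C t).1 ∧ s((run r C t).1, (run r C t).2) ∉ C t := by
      rcases hspec t with ⟨-, hne, -, h⟩ | ⟨-, heq, hne, h⟩
      · exact ⟨hne, h⟩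
      · exact ⟨heq.trans_ne hne.symm, h _⟩
    refine ⟨by simpa using hfree.1.symm, fun β hβ he => hfree.2 ?_⟩
    exact ⟨β, hβ.trans (hlen t), hβ, he⟩
  have hd : IsRun r C (run r C) :=
    ⟨fun s t hst => ⟨_, hlen s, makerPosition_strictMono hst, hmove s⟩, hspec⟩
  obtain ⟨B, hBκ, hB⟩ := hd.exists_clique hU hκ hV (mk_ord_toType κ) hIio hdiff
  rw [← hV, Cardinal.le_def] at hBκ
  obtain ⟨f⟩ := hBκ
  have hclaimed : ∀ x y, x ∈ links (run r C) y → s(y, x) ∈ p.claimed (biasedMakerTurn k) := by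
    rintro x y ⟨t, ht⟩
    exact ⟨_, hlen t, biasedMakerTurn_makerPosition t, by rw [hmove, ht]⟩
  have hf : Function.Injective fun v => (f v : V) := Subtype.val_injective.comp f.injective
  refine ⟨⟨fun v => (f v : V), fun {v w} hvw => ?_⟩, hf⟩
  have hne : (f v : V) ≠ f w := hf.ne hvw
  rw [SimpleGraph.fromEdgeSet_adj]
  refine ⟨?_, hne⟩
  rcases hB _ (f v).2 _ (f w).2 hne with h | h
  · rw [Sym2.eq_swap]
    exact hclaimed _ _ h
  · exact hclaimed _ _ h

end Strategy

end CliqueGame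

theorem Ultrafilter.hyperfilter_isCompleteFree (V : Type u) [Infinite V] :
    (Filter.hyperfilter V).IsCompleteFree ℵ₀ where
  sInter_mem _ hs h := (Filter.sInter_mem (Cardinal.lt_aleph0_iff_set_finite.1 hs)).2 h
  finite_notMem _ hA := Filter.notMem_hyperfilter_of_finite hA

/-- Let `κ` be either `ω` or an uncountable cardinal carrying
a `κ`-complete nonprincipal ultrafilter, and let `k > 0`.  In the biased
Maker–Breaker game on `K_κ` in which every turn begins with Breaker claiming
`k` previously unclaimed edges (or all remaining edges if fewer remain), after
which Maker claims one previously unclaimed edge, Maker has a strategy ensuring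
that at the end of the game her claimed edges contain a copy of `K_κ`. -/
theorem makerWins_biased_complete
    (k : ℕ) (hk : 0 < k) (V : Type u)
    (hV : #V = ℵ₀ ∨
      (ℵ₀ < #V ∧ ∃ U : Ultrafilter V,
        (∀ s : Set (Set V), #s < #V → (∀ A ∈ s, A ∈ U) → ⋂₀ s ∈ U) ∧
        (∀ A : Set V, A.Finite → A ∉ U))) :
    ∃ σ : MBStrategy (Sym2 V),
      σ.IsLegal (⊤ : SimpleGraph V).edgeSet (biasedMakerTurn k) ∧
      ∀ p : MBPlay (⊤ : SimpleGraph V).edgeSet, p.Follows (biasedMakerTurn k) σ →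
        ContainsCopy (SimpleGraph.fromEdgeSet (p.claimed (biasedMakerTurn k)))
          (⊤ : SimpleGraph V) := by
  obtain ⟨hκ, U, hU⟩ : ℵ₀ ≤ #V ∧ ∃ U : Ultrafilter V, U.IsCompleteFree #V := by
    rcases hV with h | ⟨h, U, hU, hU'⟩
    · have : Infinite V := Cardinal.infinite_iff.2 h.ge
      exact ⟨h.ge, _, h ▸ Ultrafilter.hyperfilter_isCompleteFree V⟩
    · exact ⟨h.le, U, hU, hU'⟩
  obtain ⟨r⟩ : Nonempty V := mk_ne_zero_iff.1 (aleph0_pos.trans_le hκ).ne'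
  exact ⟨CliqueGame.strategy k (#V).ord r, CliqueGame.strategy_isLegal _ _ _ _,
    fun p hp => CliqueGame.strategy_wins hκ rfl hU r p hp⟩
end
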